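/- Let G be an m-regular triangle-free finite graph on n vertices with m>1, and run the KCIP on G with parameter p=c/n started from a configuration with exactly one vertex labeled 1. Then there is a constant C depending only on c and m such that for all n sufficiently large, |E[ζ_triple] − n³/(c²m(m−1))| ≤ C·n². -/

import Mathlib

open scoped Classical
open Finset

noncomputable section

/-- The number of particles (vertices labelled `1`) of a configuration. -/
def numParticles {V : Type*} [Fintype V] (x : V → Bool) : ℕ :=
  (Finset.univ.filter fun v => x v = true).card

/-- One-step transition kernel of the kinetically constrained Ising process (KCIP)
on the graph `G` with density parameter `p`: a uniformly chosen vertex `v` is updated,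
and its label is resampled (to `1` with probability `p`, to `0` otherwise) iff `v` has at
least one neighbour labelled `1`. -/
def kcipKernel {V : Type*} [Fintype V] (G : SimpleGraph V) (p : ℝ) (x y : V → Bool) : ℝ :=
  ((Fintype.card V : ℝ))⁻¹ * ∑ v : V,
    (if ∀ w, w ≠ v → y w = x w then
      (if ∃ u, G.Adj u v ∧ x u = true then (if y v = true then p else 1 - p)
       else (if y v = x v then 1 else 0))
     else 0)

/-- Probability that the Markov chain with kernel `K` started at `x` produces a
trajectory `(X_0, …, X_T)` lying in the event `A`. -/
def trajProb {Ω : Type*} [Fintype Ω] (K : Ω → Ω → ℝ) (x : Ω) (T : ℕ)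
    (A : (Fin (T + 1) → Ω) → Prop) : ℝ :=
  ∑ ω : Fin (T + 1) → Ω,
    if ω 0 = x ∧ A ω then ∏ i : Fin T, K (ω i.castSucc) (ω i.succ) else 0

/-- Expectation of a functional `f` of the trajectory `(X_0, …, X_T)` of the Markov chain
with kernel `K` started at `x`. -/
def trajExp {Ω : Type*} [Fintype Ω] (K : Ω → Ω → ℝ) (x : Ω) (T : ℕ)
    (f : (Fin (T + 1) → Ω) → ℝ) : ℝ :=
  ∑ ω : Fin (T + 1) → Ω,
    (if ω 0 = x then ∏ i : Fin T, K (ω i.castSucc) (ω i.succ) else 0) * f ω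

/-- The `d`-dimensional discrete torus `Z_L^d`: vertices are `Fin d → ZMod L`, with an edge
between `u` and `v` iff `u - v = ± e_i` for some coordinate vector `e_i`. -/
def torusGraph (L d : ℕ) : SimpleGraph (Fin d → ZMod L) :=
  SimpleGraph.fromRel fun u v => ∃ i : Fin d, v = u + fun j => if j = i then (1 : ZMod L) else 0

/-- The expected triple time `E[ζ_triple]`, `ζ_triple = inf {t : V_t ≥ 3}`, of the KCIP with
kernel `K` started at `x`, computed via `E[ζ] = Σ_{t≥0} P[ζ > t]`, where
`P[ζ > t] = P[∀ s ≤ t, V_s < 3]`. -/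
def expectedTripleTime {V : Type*} [Fintype V] (K : (V → Bool) → (V → Bool) → ℝ)
    (x : V → Bool) : ℝ :=
  ∑' t : ℕ, trajProb K x t (fun ω => ∀ s : Fin (t + 1), numParticles (ω s) < 3)

theorem trajProb_zero {Ω : Type*} [Fintype Ω] (K : Ω → Ω → ℝ) (P : Ω → Prop) (x : Ω) :
    trajProb K x 0 (fun ω => ∀ s, P (ω s)) = if P x then 1 else 0 := by
  unfold trajProb
  rw [Fintype.sum_equiv (Equiv.funUnique (Fin 1) Ω) _
    (fun y => if y = x ∧ P y then (1 : ℝ) else 0)]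
  · by_cases h : P x
    · rw [Finset.sum_eq_single x] <;> simp +contextual [h]
    · rw [if_neg h]
      refine Finset.sum_eq_zero fun y _ => if_neg ?_
      rintro ⟨rfl, hy⟩
      exact h hy
  · intro ω
    have : (∀ s : Fin (0 + 1), P (ω s)) ↔ P (ω 0) := by
      refine ⟨fun h => h 0, fun h s => ?_⟩
      rwa [Fin.fin_one_eq_zero s]
    simp [this]

/-- First-step analysis for the probability that a Markov chain stays in `P`. -/
theorem trajProb_succ {Ω : Type*} [Fintype Ω] (K : Ω → Ω → ℝ) (P : Ω → Prop) (x : Ω) (T : ℕ) :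
    trajProb K x (T + 1) (fun ω => ∀ s, P (ω s)) =
      if P x then ∑ y, K x y * trajProb K y T (fun ω => ∀ s, P (ω s)) else 0 := by
  have h1 : trajProb K x (T + 1) (fun ω => ∀ s, P (ω s)) =
      ∑ a : Ω, ∑ ω : Fin (T + 1) → Ω,
        if (a = x ∧ P a) ∧ ∀ s, P (ω s) then
          K a (ω 0) * ∏ i : Fin T, K (ω i.castSucc) (ω i.succ) else 0 := by
    unfold trajProb
    rw [← Fintype.sum_prod_type', ← Equiv.sum_comp (Fin.consEquiv fun _ => Ω)]
    refine Finset.sum_congr rfl fun q _ => ?_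
    obtain ⟨a, ω⟩ := q
    have hc : (∀ s : Fin (T + 1 + 1), P ((Fin.consEquiv fun _ => Ω) (a, ω) s)) ↔
        P a ∧ ∀ s, P (ω s) := by
      rw [Fin.forall_fin_succ]
      simp [Fin.consEquiv]
    simp only [hc, Fin.prod_univ_succ]
    simp [Fin.consEquiv, and_assoc]
  rw [h1]
  by_cases h : P x
  · rw [if_pos h, Finset.sum_eq_single x]
    · simp only [h, and_self, true_and]
      have h2 : ∀ y, K x y * trajProb K y T (fun ω => ∀ s, P (ω s)) =
          ∑ ω : Fin (T + 1) → Ω, if ω 0 = y then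
            (if ∀ s, P (ω s) then
              K x (ω 0) * ∏ i : Fin T, K (ω i.castSucc) (ω i.succ) else 0) else 0 := by
        intro y
        unfold trajProb
        rw [Finset.mul_sum]
        refine Finset.sum_congr rfl fun ω _ => ?_
        by_cases hy : ω 0 = y
        · subst hy
          by_cases hP : ∀ s, P (ω s) <;> simp [hP]
        · simp [hy]
      simp only [h2]
      rw [Finset.sum_comm]
      simp
    · intro a _ ha
      simp [ha]
    · simp
  · rw [if_neg h]
    refine Finset.sum_eq_zero fun a _ => Finset.sum_eq_zero fun ω _ => if_neg ?_
    rintro ⟨⟨rfl, ha⟩, -⟩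
    exact h ha

theorem sum_kcipKernel_mul {V : Type*} [Fintype V] (G : SimpleGraph V) (p : ℝ) (x : V → Bool)
    (f : (V → Bool) → ℝ) :
    ∑ y, kcipKernel G p x y * f y = (Fintype.card V : ℝ)⁻¹ * ∑ v : V,
      if ∃ u, G.Adj u v ∧ x u = true then
        p * f (Function.update x v true) + (1 - p) * f (Function.update x v false)
      else f x := by
  have hval : ∀ (v : V) (g : (V → Bool) → ℝ),
      ∑ y : V → Bool, (if ∀ w, w ≠ v → y w = x w then g y else 0) =
        g (Function.update x v true) + g (Function.update x v false) := by
    intro v g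
    rw [← Finset.sum_filter]
    have : (Finset.univ.filter fun y : V → Bool => ∀ w, w ≠ v → y w = x w) =
        {Function.update x v true, Function.update x v false} := by
      ext y
      simp only [Finset.mem_filter, Finset.mem_univ, true_and, Finset.mem_insert,
        Finset.mem_singleton]
      constructor
      · intro h
        cases hy : y v
        · right
          funext w
          by_cases hw : w = v
          · subst hw; simp [hy]
          · simp [hw, h w hw]
        · left
          funext w
          by_cases hw : w = v
          · subst hw; simp [hy]
          · simp [hw, h w hw]
      · rintro (rfl | rfl) w hw <;> simp [hw]
    rw [this, Finset.sum_pair]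
    intro h
    simpa using congrFun h v
  unfold kcipKernel
  simp only [mul_assoc, Finset.sum_mul, ← Finset.mul_sum, ite_mul, zero_mul]
  rw [Finset.sum_comm]
  congr 1
  refine Finset.sum_congr rfl fun v _ => ?_
  rw [hval]
  by_cases h : ∃ u, G.Adj u v ∧ x u = true
  · simp [if_pos h]
  · simp only [if_neg h, Function.update_self]
    cases hx : x v
    · have : Function.update x v false = x := by rw [← hx, Function.update_eq_self]
      simp [this]
    · have : Function.update x v true = x := by rw [← hx, Function.update_eq_self]
      simp [this]

/-- The configuration whose particles occupy exactly the set `s`. -/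
def configOf {V : Type*} (s : Finset V) : V → Bool := fun v => decide (v ∈ s)

theorem configOf_eq_true {V : Type*} (s : Finset V) (v : V) : configOf s v = true ↔ v ∈ s := by
  simp [configOf]

theorem numParticles_configOf {V : Type*} [Fintype V] (s : Finset V) :
    numParticles (configOf s) = s.card := by
  simp [numParticles, configOf]

theorem update_configOf_true {V : Type*} (s : Finset V) (v : V) :
    Function.update (configOf s) v true = configOf (insert v s) := by
  funext w
  by_cases h : w = v
  · subst h; simp [configOf]
  · simp [configOf, h]

theorem update_configOf_false {V : Type*} (s : Finset V) (v : V) :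
    Function.update (configOf s) v false = configOf (s.erase v) := by
  funext w
  by_cases h : w = v
  · subst h; simp [configOf]
  · simp [configOf, h]

theorem exists_eq_configOf_singleton {V : Type*} [Fintype V] {x : V → Bool}
    (hx : numParticles x = 1) : ∃ u, x = configOf {u} := by
  obtain ⟨u, hu⟩ := Finset.card_eq_one.1 hx
  refine ⟨u, funext fun w => ?_⟩
  have := Finset.ext_iff.1 hu w
  simp only [Finset.mem_filter, Finset.mem_univ, true_and, Finset.mem_singleton] at this
  simp only [configOf, Finset.mem_singleton, ← this]
  simp

/-- The probability that the process started with particle set `s` has fewer than three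
particles at all times up to `t`. -/
def survival {V : Type*} [Fintype V] (G : SimpleGraph V) (p : ℝ) (t : ℕ) (s : Finset V) : ℝ :=
  trajProb (kcipKernel G p) (configOf s) t (fun ω => ∀ i, numParticles (ω i) < 3)

theorem survival_zero {V : Type*} [Fintype V] (G : SimpleGraph V) (p : ℝ) (s : Finset V) :
    survival G p 0 s = if s.card < 3 then 1 else 0 := by
  unfold survival
  rw [trajProb_zero _ (fun x => numParticles x < 3), numParticles_configOf]
  congr

theorem survival_succ {V : Type*} [Fintype V] (G : SimpleGraph V) (p : ℝ) (t : ℕ)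
    (s : Finset V) :
    survival G p (t + 1) s = if s.card < 3 then
      (Fintype.card V : ℝ)⁻¹ * ∑ v : V, (if ∃ u ∈ s, G.Adj u v then
        p * survival G p t (insert v s) + (1 - p) * survival G p t (s.erase v)
      else survival G p t s) else 0 := by
  unfold survival
  rw [trajProb_succ _ (fun x => numParticles x < 3), numParticles_configOf, sum_kcipKernel_mul]
  simp only [update_configOf_true, update_configOf_false, configOf_eq_true, and_comm]

theorem survival_of_three_le {V : Type*} [Fintype V] (G : SimpleGraph V) (p : ℝ) (t : ℕ)
    {s : Finset V} (hs : 3 ≤ s.card) : survival G p t s = 0 := by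
  cases t with
  | zero => rw [survival_zero, if_neg hs.not_gt]
  | succ t => rw [survival_succ, if_neg hs.not_gt]

/-- Survival probabilities of the two-state chain with killing which moves from the first state
to the second with probability `a`, back with probability `b`, and is killed in the second
state with probability `d`; the components are indexed by the starting state. -/
def twoStateSurvival (a b d : ℝ) : ℕ → ℝ × ℝ
  | 0 => (1, 1)
  | t + 1 =>
    let q := twoStateSurvival a b d t
    ((1 - a) * q.1 + a * q.2, b * q.1 + (1 - b - d) * q.2)

theorem survival_eq_twoStateSurvival {V : Type*} [Fintype V] [Nonempty V] (G : SimpleGraph V)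
    (p : ℝ) (m : ℕ) (hdeg : ∀ u, (Finset.univ.filter (G.Adj u)).card = m) (hG : G.CliqueFree 3)
    (t : ℕ) :
    (∀ u, survival G p t {u} = (twoStateSurvival (m * p / Fintype.card V)
      (2 * (1 - p) / Fintype.card V) (2 * (m - 1) * p / Fintype.card V) t).1) ∧
    ∀ u v, G.Adj u v → survival G p t {u, v} = (twoStateSurvival (m * p / Fintype.card V)
      (2 * (1 - p) / Fintype.card V) (2 * (m - 1) * p / Fintype.card V) t).2 := by
  have hn : (Fintype.card V : ℝ) ≠ 0 := by exact_mod_cast Fintype.card_ne_zero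
  have hsum : ∀ u r, ∑ w, (if G.Adj u w then r else (0 : ℝ)) = m * r := by
    intro u r
    rw [← Finset.sum_filter, Finset.sum_const, hdeg, nsmul_eq_mul]
  induction t with
  | zero =>
    refine ⟨fun u => ?_, fun u v h => ?_⟩
    · simp [survival_zero, twoStateSurvival]
    · simp [survival_zero, twoStateSurvival, Finset.card_pair h.ne]
  | succ t ih =>
    obtain ⟨ih1, ih2⟩ := ih
    simp only [twoStateSurvival]
    set q := twoStateSurvival (m * p / Fintype.card V)
      (2 * (1 - p) / Fintype.card V) (2 * (m - 1) * p / Fintype.card V) t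
    refine ⟨fun u => ?_, fun u v h => ?_⟩
    · rw [survival_succ, if_pos (by simp)]
      have key : ∀ w, (if ∃ u' ∈ ({u} : Finset V), G.Adj u' w then
          p * survival G p t (insert w {u}) + (1 - p) * survival G p t (({u} : Finset V).erase w)
          else survival G p t {u}) =
          q.1 + if G.Adj u w then p * (q.2 - q.1) else 0 := by
        intro w
        simp only [Finset.mem_singleton, exists_eq_left]
        split_ifs with hw
        · rw [ih2 w u hw.symm, Finset.erase_eq_of_notMem (by simpa using hw.ne'), ih1]
          ring
        · rw [ih1, add_zero]
      rw [Finset.sum_congr rfl fun w _ => key w, Finset.sum_add_distrib, hsum]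
      simp only [Finset.sum_const, Finset.card_univ, nsmul_eq_mul]
      field_simp
      ring
    · rw [survival_succ, if_pos (by rw [Finset.card_pair h.ne]; norm_num)]
      have key : ∀ w, (if ∃ u' ∈ ({u, v} : Finset V), G.Adj u' w then
          p * survival G p t (insert w {u, v}) +
            (1 - p) * survival G p t (({u, v} : Finset V).erase w)
          else survival G p t {u, v}) =
          q.2 + (if w = u then (1 - p) * (q.1 - q.2) + p * q.2 else 0) +
            (if w = v then (1 - p) * (q.1 - q.2) + p * q.2 else 0) +
            (if G.Adj u w then -(p * q.2) else 0) + (if G.Adj v w then -(p * q.2) else 0) := by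
        intro w
        have hex : (∃ u' ∈ ({u, v} : Finset V), G.Adj u' w) ↔ G.Adj u w ∨ G.Adj v w := by simp
        rw [if_congr hex rfl rfl, ih2 u v h]
        by_cases hu : w = u
        · subst hu
          have he : ({w, v} : Finset V).erase w = {v} :=
            Finset.erase_insert (by simpa using h.ne)
          simp [h.symm, h.ne, he, ih1, ih2 w v h]
          ring
        by_cases hv : w = v
        · subst hv
          have he : ({u, w} : Finset V).erase w = {u} := by
            rw [Finset.pair_comm]
            exact Finset.erase_insert (by simpa using h.ne')
          simp [h, h.ne', he, ih1, ih2 u w h]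
          ring
        have hmem : w ∉ ({u, v} : Finset V) := by simp [hu, hv]
        have h3 : survival G p t (insert w {u, v}) = 0 := survival_of_three_le G p t (by
          rw [Finset.card_insert_of_notMem hmem, Finset.card_pair h.ne])
        have hnot : ¬(G.Adj u w ∧ G.Adj v w) := fun ⟨h1, h2⟩ =>
          hG {u, v, w} (SimpleGraph.is3Clique_triple_iff.2 ⟨h, h1, h2⟩)
        rw [h3, Finset.erase_eq_of_notMem hmem, ih2 u v h]
        by_cases h1 : G.Adj u w
        · have h2 : ¬G.Adj v w := fun h2 => hnot ⟨h1, h2⟩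
          simp [hu, hv, h1, h2]
          ring
        · by_cases h2 : G.Adj v w
          · simp [hu, hv, h1, h2]
            ring
          · simp [hu, hv, h1, h2]
      rw [Finset.sum_congr rfl fun w _ => key w]
      simp only [Finset.sum_add_distrib, hsum, Finset.sum_ite_eq', Finset.mem_univ, if_true,
        Finset.sum_const, Finset.card_univ, nsmul_eq_mul]
      field_simp
      ring

theorem tsum_twoStateSurvival_fst {a b d : ℝ} (ha : 0 < a) (ha1 : a ≤ 1) (hb : 0 ≤ b)
    (hd : 0 < d) (hbd : b + d ≤ 1) :
    ∑' t, (twoStateSurvival a b d t).1 = (b + d) / (a * d) + 1 / d := by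
  set f := fun t => (twoStateSurvival a b d t).1 with hf
  set g := fun t => (twoStateSurvival a b d t).2 with hg
  have f0 : f 0 = 1 := rfl
  have g0 : g 0 = 1 := rfl
  have fs : ∀ t, f (t + 1) = (1 - a) * f t + a * g t := fun t => rfl
  have gs : ∀ t, g (t + 1) = b * f t + (1 - b - d) * g t := fun t => rfl
  have hnn : ∀ t, 0 ≤ f t ∧ 0 ≤ g t := by
    intro t
    induction t with
    | zero => simp [f0, g0]
    | succ t ih =>
      rw [fs, gs]
      have h1 : 0 ≤ 1 - a := by linarith
      have h2 : 0 ≤ 1 - b - d := by linarith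
      exact ⟨add_nonneg (mul_nonneg h1 ih.1) (mul_nonneg ha.le ih.2),
        add_nonneg (mul_nonneg hb ih.1) (mul_nonneg h2 ih.2)⟩
  set A := (b + d) / (a * d) + 1 / d with hA
  have hAeq : b * A + (1 - b - d) * (A - 1 / a) + 1 = A - 1 / a := by
    rw [hA]
    field_simp
    ring
  have hbound : ∀ T, ∑ t ∈ Finset.range T, f t ≤ A ∧ ∑ t ∈ Finset.range T, g t ≤ A - 1 / a := by
    intro T
    induction T with
    | zero =>
      have : A - 1 / a = b / (a * d) + 1 / d := by
        rw [hA]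
        field_simp
        ring
      simp only [Finset.range_zero, Finset.sum_empty]
      rw [this]
      exact ⟨by positivity, by positivity⟩
    | succ T ih =>
      rw [Finset.sum_range_succ', Finset.sum_range_succ']
      simp only [fs, gs, f0, g0, Finset.sum_add_distrib, ← Finset.mul_sum]
      have h1 := mul_le_mul_of_nonneg_left ih.1 (by linarith : 0 ≤ 1 - a)
      have h2 := mul_le_mul_of_nonneg_left ih.2 ha.le
      have h3 := mul_le_mul_of_nonneg_left ih.1 hb
      have h4 := mul_le_mul_of_nonneg_left ih.2 (by linarith : 0 ≤ 1 - b - d)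
      have h5 : a * (A - 1 / a) = a * A - 1 := by field_simp
      constructor <;> linarith
  have hfs : Summable f := summable_of_sum_range_le (fun t => (hnn t).1) fun T => (hbound T).1
  have hgs : Summable g := summable_of_sum_range_le (fun t => (hnn t).2) fun T => (hbound T).2
  have e1 := hfs.tsum_eq_zero_add
  have e2 := hgs.tsum_eq_zero_add
  simp only [fs, gs, f0, g0] at e1 e2
  rw [(hfs.mul_left _).tsum_add (hgs.mul_left _), tsum_mul_left, tsum_mul_left] at e1 e2
  change ∑' t, f t = A
  rw [hA]
  have ha0 := ha.ne'
  have hd0 := hd.ne'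
  field_simp
  linear_combination (b + d) * e1 + a * e2

theorem expectedTripleTime_kcipKernel {V : Type*} [Fintype V] (G : SimpleGraph V) {p : ℝ}
    (hp : 0 < p) (hp1 : p ≤ 1) {m : ℕ} (hm : 1 < m) (hn : 2 * m ≤ Fintype.card V)
    (hdeg : ∀ u, (Finset.univ.filter (G.Adj u)).card = m) (hG : G.CliqueFree 3)
    {x : V → Bool} (hx : numParticles x = 1) :
    expectedTripleTime (kcipKernel G p) x =
      Fintype.card V * (1 - p) / (m * (m - 1) * p ^ 2) + Fintype.card V / (m * p) +
        Fintype.card V / (2 * (m - 1) * p) := by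
  obtain ⟨u, rfl⟩ := exists_eq_configOf_singleton hx
  have : Nonempty V := ⟨u⟩
  have hn0 : (0 : ℝ) < Fintype.card V := by exact_mod_cast Fintype.card_pos
  have hn' : 2 * (m : ℝ) ≤ Fintype.card V := by exact_mod_cast hn
  have hm1 : (0 : ℝ) < m - 1 := by
    have : (1 : ℝ) < m := by exact_mod_cast hm
    linarith
  have hm0 : (0 : ℝ) < m := by linarith
  have hmp : m * p ≤ m := mul_le_of_le_one_right hm0.le hp1
  have hE : expectedTripleTime (kcipKernel G p) (configOf {u}) =
      ∑' t, (twoStateSurvival (m * p / Fintype.card V)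
        (2 * (1 - p) / Fintype.card V) (2 * (m - 1) * p / Fintype.card V) t).1 :=
    tsum_congr fun t => (survival_eq_twoStateSurvival G p m hdeg hG t).1 u
  rw [hE, tsum_twoStateSurvival_fst]
  · field_simp
  · positivity
  · rw [div_le_one hn0]
    linarith
  · have : 0 ≤ 1 - p := by linarith
    positivity
  · positivity
  · rw [← add_div, div_le_one hn0]
    nlinarith

/-- Let `G` be an `m`-regular triangle-free finite graph on `n` vertices
with `m > 1`, and run the KCIP on `G` with `p = c/n` started from a configuration with exactly
one particle. Then there is a constant `C` depending only on `c` and `m` such that for all `n`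
sufficiently large, `|E[ζ_triple] − n³/(c²m(m−1))| ≤ C n²`. -/
theorem kcip_expected_triple_time (c : ℝ) (hc : 0 < c) (m : ℕ) (hm : 1 < m) :
    ∃ C : ℝ, ∃ N : ℕ,
      ∀ (V : Type) (_ : Fintype V) (_ : DecidableEq V) (G : SimpleGraph V)
        (_ : DecidableRel G.Adj),
        N < Fintype.card V → G.IsRegularOfDegree m → G.CliqueFree 3 →
        ∀ x : V → Bool, numParticles x = 1 →
        |expectedTripleTime (kcipKernel G (c / (Fintype.card V : ℝ))) x -
            (Fintype.card V : ℝ) ^ 3 / (c ^ 2 * m * ((m : ℝ) - 1))| ≤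
          C * (Fintype.card V : ℝ) ^ 2 := by
  have hm1 : (0 : ℝ) < m - 1 := by
    have : (1 : ℝ) < m := by exact_mod_cast hm
    linarith
  have hm0 : (0 : ℝ) < m := by linarith
  refine ⟨(3 * m - 4) / (2 * c * m * (m - 1)), max (2 * m) ⌈c⌉₊, ?_⟩
  intro V _ _ G _ hN hreg hG x hx
  have hn0 : (0 : ℝ) < Fintype.card V := by exact_mod_cast (Nat.zero_le _).trans_lt hN
  have hcn : c ≤ Fintype.card V :=
    (Nat.le_ceil c).trans (by exact_mod_cast (le_max_right _ _).trans hN.le)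
  have hdeg : ∀ u, (@Finset.filter V (G.Adj u) (Classical.decPred _) Finset.univ).card = m := by
    intro u
    rw [← hreg u, ← SimpleGraph.card_neighborFinset_eq_degree]
    congr 1
    ext w
    simp only [Finset.mem_filter, Finset.mem_univ, true_and, SimpleGraph.mem_neighborFinset]
  rw [expectedTripleTime_kcipKernel G (div_pos hc hn0) ((div_le_one hn0).2 hcn) hm
    ((le_max_left _ _).trans hN.le) hdeg hG hx]
  refine le_of_eq ?_
  have hm4 : (0 : ℝ) ≤ 3 * m - 4 := by
    have : (2 : ℝ) ≤ m := by exact_mod_cast hm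
    linarith
  rw [← abs_of_nonneg (by positivity : 0 ≤ (3 * m - 4) / (2 * c * m * ((m : ℝ) - 1)) * (Fintype.card V : ℝ) ^ 2)]
  congr 1
  field_simp
  ring
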